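/- Let U be an infinite subset of ℤ and let f be a LIP function on U such that |f(x)| is a prime number for infinitely many x ∈ U. Then f is irreducible in LIP(U): whenever g and h are LIP functions on U with f(x) = g(x)·h(x) for all x ∈ U, either g is identically 1 or identically −1 on U, or h is identically 1 or identically −1 on U. -/

import Mathlib

/-- A function `f` is locally integer polynomial (LIP) on `U ⊆ ℤ` if its restriction
to every finite subset of `U` agrees with some integer polynomial. -/
def IsLIP (U : Set ℤ) (f : ℤ → ℤ) : Prop :=
  ∀ X : Finset ℤ, ↑X ⊆ U → ∃ p : Polynomial ℤ, ∀ x ∈ X, p.eval x = f x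

theorem IsLIP.sub_dvd_sub {U : Set ℤ} {g : ℤ → ℤ} (hg : IsLIP U g) {x y : ℤ}
    (hx : x ∈ U) (hy : y ∈ U) : x - y ∣ g x - g y := by
  obtain ⟨p, hp⟩ := hg {x, y} (by simp [Set.insert_subset_iff, hx, hy])
  rw [← hp x (by simp), ← hp y (by simp)]
  exact p.sub_dvd_eval_sub x y

/-- A LIP function taking the value `c` infinitely often is constant. -/
theorem IsLIP.eq_of_infinite {U : Set ℤ} {g : ℤ → ℤ} (hg : IsLIP U g) {c : ℤ}
    (hc : {x ∈ U | g x = c}.Infinite) : ∀ y ∈ U, g y = c := by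
  intro y hy
  by_contra hne
  refine hc ((Set.finite_Icc (y - |c - g y|) (y + |c - g y|)).subset ?_)
  rintro x ⟨hx, rfl⟩
  have hle : |x - y| ≤ |g x - g y| :=
    Int.le_of_dvd (abs_pos.2 (sub_ne_zero.2 (Ne.symm hne)))
      ((abs_dvd_abs _ _).2 (hg.sub_dvd_sub hx hy))
  rw [abs_le] at hle
  constructor <;> linarith [hle.1, hle.2]

/-- if `f ∈ LIP(U)` takes prime absolute values at infinitely many
points of `U`, then `f` is irreducible in `LIP(U)`. -/
theorem stmt_5 (U : Set ℤ) (hU : U.Infinite) (f : ℤ → ℤ) (hf : IsLIP U f)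
    (hprime : {x ∈ U | Nat.Prime (f x).natAbs}.Infinite) :
    ∀ g h : ℤ → ℤ, IsLIP U g → IsLIP U h → (∀ x ∈ U, f x = g x * h x) →
      (∀ x ∈ U, g x = 1) ∨ (∀ x ∈ U, g x = -1) ∨
      (∀ x ∈ U, h x = 1) ∨ (∀ x ∈ U, h x = -1) := by
  intro g h hg hh hfgh
  by_contra! hcon
  obtain ⟨⟨a, ha, hga⟩, ⟨b, hb, hgb⟩, ⟨c, hc, hhc⟩, ⟨d, hd, hhd⟩⟩ := hcon
  have hg₁ : {x ∈ U | g x = 1}.Finite :=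
    Set.not_infinite.1 fun hinf => hga (hg.eq_of_infinite hinf a ha)
  have hg₂ : {x ∈ U | g x = -1}.Finite :=
    Set.not_infinite.1 fun hinf => hgb (hg.eq_of_infinite hinf b hb)
  have hh₁ : {x ∈ U | h x = 1}.Finite :=
    Set.not_infinite.1 fun hinf => hhc (hh.eq_of_infinite hinf c hc)
  have hh₂ : {x ∈ U | h x = -1}.Finite :=
    Set.not_infinite.1 fun hinf => hhd (hh.eq_of_infinite hinf d hd)
  refine hprime (((hg₁.union hg₂).union (hh₁.union hh₂)).subset ?_)
  rintro x ⟨hx, hpx⟩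
  have hirr : Irreducible (g x * h x) := by
    rw [← hfgh x hx]
    exact (Int.prime_iff_natAbs_prime.2 hpx).irreducible
  rcases hirr.isUnit_or_isUnit rfl with hu | hu
  · rcases Int.isUnit_iff.1 hu with h₁ | h₁
    · exact Or.inl (Or.inl ⟨hx, h₁⟩)
    · exact Or.inl (Or.inr ⟨hx, h₁⟩)
  · rcases Int.isUnit_iff.1 hu with h₁ | h₁
    · exact Or.inr (Or.inl ⟨hx, h₁⟩)
    · exact Or.inr (Or.inr ⟨hx, h₁⟩)
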